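/- arXiv:1905.03047 — 2 statements merged into one kernel-verified Lean document; each statement's English description precedes it below -/
import Mathlib

section
/- Let n ≥ 2 and let a, b ∈ ℂⁿ be such that for every index i there exists j with P_{ij} ≠ 0 (the spanned 2-plane lies in no coordinate hyperplane). Suppose there exists t = (t_1,…,t_n) ∈ (ℂ*)ⁿ which is not constant (t_i ≠ t_j for some i, j) and satisfies t_i t_j P_{ij} = P_{ij} for all i, j (i.e. t fixes the plane and is not in the diagonal). Then there exists a subset I ⊆ {1,…,n} with I ≠ ∅ and I ≠ {1,…,n} such that for all i ≠ j: P_{ij} = 0 if and only if (i ∈ I ↔ j ∈ I). That is, the relation i ∼ j given by (i = j or P_{ij} = 0) is an equivalence relation with exactly two equivalence classes I and its complement J. -/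
/-- The Plücker coordinate `P_{ij} = a_i b_j - a_j b_i` of a pair of vectors. -/
noncomputable def plucker {ι : Type*} (a b : ι → ℂ) (i j : ι) : ℂ :=
  a i * b j - a j * b i

/-- Symmetry of the vanishing of Plücker coordinates. -/
theorem plucker_eq_zero_symm {ι : Type*} {a b : ι → ℂ} {i j : ι}
    (h : plucker a b i j = 0) : plucker a b j i = 0 := by
  unfold plucker at *
  linear_combination -h

/-- Vanishing of Plücker coordinates is transitive through an index whose row is nonzero. -/
theorem plucker_eq_zero_trans {ι : Type*} {a b : ι → ℂ} {i j k : ι}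
    (hj : ∃ l, plucker a b j l ≠ 0) (hij : plucker a b i j = 0) (hjk : plucker a b j k = 0) :
    plucker a b i k = 0 := by
  obtain ⟨l, hl⟩ := hj
  unfold plucker at *
  by_cases ha : a j = 0
  · have hb : b j ≠ 0 := by
      intro hb
      simp [ha, hb] at hl
    apply mul_left_cancel₀ hb
    linear_combination b i * hjk + b k * hij
  · apply mul_left_cancel₀ ha
    linear_combination a i * hjk + a k * hij

/-- If a plane lying in no coordinate hyperplane has a nontrivial stabilizer in the torus
`(ℂ*)ⁿ`, then the vanishing of Plücker coordinates is governed by a partition of the index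
set into exactly two equivalence classes `I` and its complement. -/
theorem stabilizer_gives_two_classes {n : ℕ} (hn : 2 ≤ n) (a b : Fin n → ℂ)
    (hplane : ∀ i : Fin n, ∃ j : Fin n, plucker a b i j ≠ 0)
    (t : Fin n → ℂ) (ht0 : ∀ i, t i ≠ 0)
    (htnc : ∃ i j : Fin n, t i ≠ t j)
    (hfix : ∀ i j : Fin n, t i * t j * plucker a b i j = plucker a b i j) :
    ∃ I : Set (Fin n), I.Nonempty ∧ I ≠ Set.univ ∧
      ∀ i j : Fin n, i ≠ j → (plucker a b i j = 0 ↔ (i ∈ I ↔ j ∈ I)) := by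
  have trans {i j k : Fin n} (hij : plucker a b i j = 0) (hjk : plucker a b j k = 0) :
      plucker a b i k = 0 := plucker_eq_zero_trans (hplane j) hij hjk
  have inv {i j : Fin n} (h : plucker a b i j ≠ 0) : t i * t j = 1 :=
    mul_right_cancel₀ h (by rw [hfix, one_mul])
  have eq_of_inv {i j k : Fin n} (hi : plucker a b i k ≠ 0) (hj : plucker a b j k ≠ 0) :
      t i = t j := mul_right_cancel₀ (ht0 k) ((inv hi).trans (inv hj).symm)
  obtain ⟨p, q, hpq⟩ := htnc
  have hP : plucker a b p q ≠ 0 := by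
    intro h
    obtain ⟨k, hk⟩ := hplane p
    exact hpq (eq_of_inv hk fun hqk => hk (trans h hqk))
  have cover (k : Fin n) : plucker a b p k = 0 ∨ plucker a b q k = 0 := by
    by_contra! h
    exact hpq (eq_of_inv h.1 h.2)
  refine ⟨{k | plucker a b p k = 0}, ⟨p, sub_self _⟩,
    fun h => hP (h.symm ▸ Set.mem_univ q : q ∈ {k | plucker a b p k = 0}), ?_⟩
  intro i j _
  simp only [Set.mem_ofPred_eq]
  refine ⟨fun h => ⟨fun hi => trans hi h, fun hj => trans hj (plucker_eq_zero_symm h)⟩,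
    fun h => ?_⟩
  by_cases hi : plucker a b p i = 0
  · exact trans (plucker_eq_zero_symm hi) (h.1 hi)
  · exact trans (plucker_eq_zero_symm ((cover i).resolve_left hi))
      ((cover j).resolve_left fun hj => hi (h.2 hj))
end

section
/- Let n ≥ 2 and let a, b, c, d ∈ ℂⁿ be such that all Plücker coordinates P_{ij}(L) = a_i b_j − a_j b_i and P_{ij}(M) = c_i d_j − c_j d_i are nonzero for i ≠ j. Then the following are equivalent: (1) there exists t = (t_1,…,t_n) ∈ (ℂ*)ⁿ such that P_{ij}(M) = t_i t_j P_{ij}(L) for all i, j (i.e. M lies in the torus orbit of L); (2) for all pairwise distinct i, j, k, l one has P_{ik}(M) P_{jl}(M) P_{il}(L) P_{jk}(L) = P_{il}(M) P_{jk}(M) P_{ik}(L) P_{jl}(L) (i.e. all cross-ratios of M equal the corresponding cross-ratios of L). -/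
theorem plucker_swap {ι : Type*} (a b : ι → ℂ) (i j : ι) :
    plucker a b j i = -plucker a b i j := by
  unfold plucker; ring

theorem plucker_self {ι : Type*} (a b : ι → ℂ) (i : ι) : plucker a b i i = 0 :=
  sub_self _

/-- If `r` is symmetric and satisfies the four-point condition, then `r o i * r o j / r i j` is
independent of the choice of distinct `i, j` different from `o`. -/
theorem mul_mul_eq_of_fourPoint {ι K : Type*} [CommRing K] {r : ι → ι → K}
    (hsymm : ∀ i j, r i j = r j i)
    (h : ∀ i j k l, i ≠ j → i ≠ k → i ≠ l → j ≠ k → j ≠ l → k ≠ l →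
      r i k * r j l = r i l * r j k)
    {o p q i j : ι} (hp : p ≠ o) (hq : q ≠ o) (hpq : p ≠ q)
    (hi : i ≠ o) (hj : j ≠ o) (hij : i ≠ j) :
    r o i * r o j * r p q = r o p * r o q * r i j := by
  have step (x y z : ι) (hx : x ≠ o) (hy : y ≠ o) (hz : z ≠ o) (hxy : x ≠ y) (hxz : x ≠ z) :
      r o y * r x z = r o z * r x y := by
    by_cases hyz : y = z
    · rw [hyz]
    · exact h o x y z hx.symm hy.symm hz.symm hxy hxz hyz
  by_cases hjp : j = p
  · subst hjp
    linear_combination r o j * step j i q hj hi hq hij.symm hpq + r o j * r o q * hsymm j i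
  · have h₁ := step p j q hp hj hq (Ne.symm hjp) hpq
    have h₂ := step j i p hj hi hp hij.symm hjp
    linear_combination r o i * h₁ + r o q * h₂ + r o q * r o i * hsymm p j
      + r o q * r o p * hsymm j i

/-- Over an algebraically closed field, a symmetric function that is nonzero off the diagonal and
satisfies the four-point condition is a product `t i * t j` off the diagonal. -/
theorem exists_eq_mul_of_fourPoint {ι K : Type*} [Field K] [IsAlgClosed K]
    {r : ι → ι → K} (hsymm : ∀ i j, r i j = r j i) (hne : ∀ i j, i ≠ j → r i j ≠ 0)
    (h : ∀ i j k l, i ≠ j → i ≠ k → i ≠ l → j ≠ k → j ≠ l → k ≠ l →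
      r i k * r j l = r i l * r j k) :
    ∃ t : ι → K, (∀ i, t i ≠ 0) ∧ ∀ i j, i ≠ j → r i j = t i * t j := by
  classical
  rcases isEmpty_or_nonempty ι with _ | ⟨⟨o⟩⟩
  · exact ⟨fun _ => 1, isEmptyElim, isEmptyElim⟩
  obtain ⟨s, hs, hsq⟩ : ∃ s : K, s ≠ 0 ∧ ∀ i j, i ≠ o → j ≠ o → i ≠ j →
      r o i * r o j = s ^ 2 * r i j := by
    by_cases hpair : ∃ p q, p ≠ o ∧ q ≠ o ∧ p ≠ q
    · obtain ⟨p, q, hp, hq, hpq⟩ := hpair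
      have hr := hne p q hpq
      obtain ⟨s, hs⟩ := IsAlgClosed.exists_pow_nat_eq (r o p * r o q / r p q) two_pos
      refine ⟨s, ?_, fun i j hi hj hij => ?_⟩
      · rintro rfl
        rw [zero_pow two_ne_zero] at hs
        exact div_ne_zero (mul_ne_zero (hne o p hp.symm) (hne o q hq.symm)) hr hs.symm
      · rw [hs, div_mul_eq_mul_div, eq_div_iff hr]
        exact mul_mul_eq_of_fourPoint hsymm h hp hq hpq hi hj hij
    · push Not at hpair
      exact ⟨1, one_ne_zero, fun i j hi hj hij => absurd (hpair i j hi hj) hij⟩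
  refine ⟨fun i => if i = o then s else r o i / s, fun i => ?_, fun i j hij => ?_⟩
  · dsimp only
    split_ifs with hi
    · exact hs
    · exact div_ne_zero (hne o i (Ne.symm hi)) hs
  · dsimp only
    split_ifs with hi hj hj
    · exact absurd (hi.trans hj.symm) hij
    · rw [hi, mul_div_cancel₀ _ hs]
    · rw [hj, div_mul_cancel₀ _ hs, hsymm]
    · rw [div_mul_div_comm, hsq i j hi hj hij, ← sq, mul_div_cancel_left₀ _ (pow_ne_zero 2 hs)]

/-- For two points of the main stratum of `G_{n,2}` (all Plücker coordinates nonzero),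
`M` lies in the torus orbit of `L` iff all cross-ratios of `M` equal the corresponding
cross-ratios of `L`. -/
theorem mem_torus_orbit_iff_crossRatios_eq {n : ℕ} (hn : 2 ≤ n) (a b c d : Fin n → ℂ)
    (hL : ∀ i j : Fin n, i ≠ j → plucker a b i j ≠ 0)
    (hM : ∀ i j : Fin n, i ≠ j → plucker c d i j ≠ 0) :
    (∃ t : Fin n → ℂ, (∀ i, t i ≠ 0) ∧
        ∀ i j : Fin n, plucker c d i j = t i * t j * plucker a b i j) ↔
    (∀ i j k l : Fin n, i ≠ j → i ≠ k → i ≠ l → j ≠ k → j ≠ l → k ≠ l →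
        plucker c d i k * plucker c d j l * plucker a b i l * plucker a b j k
          = plucker c d i l * plucker c d j k * plucker a b i k * plucker a b j l) := by
  constructor
  · rintro ⟨t, -, ht⟩ i j k l - - - - - -
    simp only [ht]
    ring
  · intro h
    obtain ⟨t, ht, hr⟩ := exists_eq_mul_of_fourPoint
      (r := fun i j => plucker c d i j / plucker a b i j)
      (fun i j => by rw [plucker_swap c d j i, plucker_swap a b j i, neg_div_neg_eq])
      (fun i j hij => div_ne_zero (hM i j hij) (hL i j hij))
      (fun i j k l hij hik hil hjk hjl hkl => by
        rw [div_mul_div_comm, div_mul_div_comm,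
          div_eq_div_iff (mul_ne_zero (hL i k hik) (hL j l hjl))
            (mul_ne_zero (hL i l hil) (hL j k hjk))]
        linear_combination h i j k l hij hik hil hjk hjl hkl)
    refine ⟨t, ht, fun i j => ?_⟩
    by_cases hij : i = j
    · rw [hij, plucker_self, plucker_self, mul_zero]
    · rw [← hr i j hij, div_mul_cancel₀ _ (hL i j hij)]
end
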